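/- arXiv:1409.7322 — 2 statements merged into one kernel-verified Lean document; each statement's English description precedes it below -/
import Mathlib

section
/- The 3x+1 conjecture holds if and only if for every positive integer x, writing x in base 3 as x_k…x_0 (most significant digit first, x_k ≠ 0), the Turing machine M6 halts when started from the initial configuration ωb (A x_k) x_{k−1} … x_0 bω. -/
namespace Collatz

/-- The 3x+1 function. -/
def T (x : ℕ) : ℕ := if x % 2 = 0 then x / 2 else (3 * x + 1) / 2

/-- The 3x+1 conjecture: iterating `T` from any positive integer
eventually reaches the loop `2 ↦ 1 ↦ 2`. -/
def CollatzConjecture : Prop :=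
  ∀ x : ℕ, 0 < x → ∃ k : ℕ, T^[k] x = 2 ∧ T^[k + 1] x = 1

inductive St | A | B | C | D | E | H
  deriving DecidableEq

inductive Sym | blank | d0 | d1 | d2
  deriving DecidableEq

open St Sym

/-- Transition table of the Turing machine `M6`
(`true` = move right, `false` = move left); `H` is the halting state,
`delta D blank` is undefined. -/
def delta : St → Sym → Option (Sym × Bool × St)
  | A, blank => some (blank, false, C)
  | A, d0    => some (d0, true, A)
  | A, d1    => some (d0, true, B)
  | A, d2    => some (d1, true, A)
  | B, blank => some (d2, false, E)
  | B, d0    => some (d1, true, B)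
  | B, d1    => some (d2, true, A)
  | B, d2    => some (d2, true, B)
  | C, blank => some (blank, true, D)
  | C, d0    => some (d0, false, C)
  | C, d1    => some (d1, false, C)
  | C, d2    => some (d2, false, C)
  | D, blank => none
  | D, d0    => some (blank, true, A)
  | D, d1    => some (blank, true, B)
  | D, d2    => some (d1, true, A)
  | E, blank => some (blank, true, H)
  | E, d0    => some (d0, false, C)
  | E, d1    => some (d1, false, C)
  | E, d2    => some (d2, false, C)
  | H, _     => none

structure Cfg where
  state : St
  head : ℤ
  tape : ℤ → Sym

/-- One step of the machine; `none` when the transition is undefined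
(in particular in the halting state, which has no transitions).
In `delta`, the `Bool` component is the direction: `true` = right, `false` = left. -/
def step (c : Cfg) : Option Cfg :=
  (delta c.state (c.tape c.head)).map fun t =>
    ⟨t.2.2, c.head + (if t.2.1 then 1 else -1), Function.update c.tape c.head t.1⟩

/-- `steps n c` is the configuration after `n` steps from `c`
(`none` if the machine has halted meanwhile). -/
def steps : ℕ → Cfg → Option Cfg
  | 0, c => some c
  | n + 1, c => (step c).bind (steps n)

/-- The tape holding the word `w` at positions `0, …, w.length - 1`,
and the blank symbol everywhere else. -/
def tapeOf (w : List Sym) : ℤ → Sym :=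
  fun i => if 0 ≤ i then w.getD i.toNat blank else blank

/-- `c` is the configuration `ωb u (q s) v bω`, where `w = u ++ s :: v` and
`pos = u.length` (i.e. the tape holds exactly the word `w` surrounded by blanks,
the machine is in state `q`, and the head scans the symbol of `w` at index `pos`). -/
def IsConfig (c : Cfg) (q : St) (w : List Sym) (pos : ℕ) : Prop :=
  c.state = q ∧ ∃ d : ℤ, c.head = d + pos ∧ c.tape = fun i => tapeOf w (i - d)

/-- The machine eventually reaches the configuration `ωb u (q s) v bω`. -/
def Reaches (c : Cfg) (q : St) (w : List Sym) (pos : ℕ) : Prop :=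
  ∃ t : ℕ, ∃ c' : Cfg, steps t c = some c' ∧ IsConfig c' q w pos

/-- The machine halts when started from configuration `c`. -/
def Halts (c : Cfg) : Prop := ∃ n : ℕ, steps n c = none

/-- Initial configuration: word `w` on the tape, head on its leftmost symbol, state `A`. -/
def initCfg (w : List Sym) : Cfg := ⟨St.A, 0, tapeOf w⟩

/-- The symbol encoding a base-3 digit. -/
def symOfDigit (n : ℕ) : Sym := if n = 0 then d0 else if n = 1 then d1 else d2

/-- The standard base-3 representation of `x`, most significant digit first. -/
def base3Word (x : ℕ) : List Sym := ((Nat.digits 3 x).reverse).map symOfDigit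

theorem steps_plus (n m : ℕ) (c : Cfg) : steps (n + m) c = (steps n c).bind (steps m) := by
  induction n generalizing c with
  | zero => simp [steps]
  | succ n ih =>
    have h : n + 1 + m = (n + m) + 1 := by omega
    rw [h]
    simp only [steps]
    cases step c with
    | none => rfl
    | some c' => simp [ih]

def Reach (c c' : Cfg) : Prop := ∃ n, steps n c = some c'

theorem Reach.rfl' (c : Cfg) : Reach c c := ⟨0, rfl⟩

theorem Reach.head {c c1 c' : Cfg} (h : step c = some c1) (h' : Reach c1 c') : Reach c c' := by
  obtain ⟨n, hn⟩ := h'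
  exact ⟨n + 1, by simp [steps, h, hn]⟩

theorem Reach.halts {c c' : Cfg} (h : Reach c c') (hc : Halts c') : Halts c := by
  obtain ⟨n, hn⟩ := h
  obtain ⟨m, hm⟩ := hc
  exact ⟨n + m, by rw [steps_plus, hn]; simpa using hm⟩

theorem Reach.back {c c' : Cfg} (h : Reach c c') {N : ℕ} (hN : steps N c = none) :
    ∃ M, M ≤ N ∧ steps M c' = none := by
  obtain ⟨n, hn⟩ := h
  by_cases hle : N ≤ n
  · obtain ⟨k, rfl⟩ := Nat.exists_eq_add_of_le hle
    rw [steps_plus, hN] at hn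
    simp at hn
  · obtain ⟨k, rfl⟩ := Nat.exists_eq_add_of_le (Nat.le_of_not_le hle)
    rw [steps_plus, hn] at hN
    exact ⟨k, by omega, by simpa using hN⟩

/-- Tape with boundary at `h`: cells left of `h` hold `l` (nearest first), others hold `r`. -/
def Z (h : ℤ) (l r : List ℕ) : ℤ → Sym := fun i =>
  if i < h then (l.map symOfDigit).getD (h - 1 - i).toNat blank
  else (r.map symOfDigit).getD (i - h).toNat blank

theorem Z_shift (h : ℤ) (d : ℕ) (l r : List ℕ) : Z (h + 1) (d :: l) r = Z h l (d :: r) := by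
  funext i
  unfold Z
  rcases lt_trichotomy i h with hi | hi | hi
  · have h1 : i < h + 1 := by omega
    have h2 : (h + 1 - 1 - i).toNat = (h - 1 - i).toNat + 1 := by omega
    simp only [h1, hi, if_true, h2, List.map_cons, List.getD_cons_succ]
  · subst hi
    simp
  · have h1 : ¬ i < h + 1 := by omega
    have h3 : ¬ i < h := by omega
    have h2 : (i - h).toNat = (i - (h + 1)).toNat + 1 := by omega
    simp only [h1, h3, if_false, h2, List.map_cons, List.getD_cons_succ]

theorem Z_head (h : ℤ) (l r : List ℕ) (d : ℕ) : Z h l (d :: r) h = symOfDigit d := by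
  simp [Z]

theorem Z_head_nil (h : ℤ) (l : List ℕ) : Z h l [] h = blank := by
  simp [Z]

theorem Z_left_nil (h : ℤ) (r : List ℕ) : Z h [] r (h - 1) = blank := by
  simp [Z]

theorem Z_write (h : ℤ) (l r : List ℕ) (d e : ℕ) :
    Function.update (Z h l (d :: r)) h (symOfDigit e) = Z (h + 1) (e :: l) r := by
  rw [Z_shift]
  funext i
  by_cases hi : i = h
  · subst hi
    simp [Z]
  · rw [Function.update_of_ne hi]
    unfold Z
    by_cases h1 : i < h
    · simp [h1]
    · have h2 : (i - h).toNat = (i - h - 1).toNat + 1 := by omega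
      simp only [h1, if_false, h2, List.map_cons, List.getD_cons_succ]

theorem Z_write_nil (h : ℤ) (l : List ℕ) (e : ℕ) :
    Function.update (Z h l []) h (symOfDigit e) = Z h l [e] := by
  funext i
  by_cases hi : i = h
  · subst hi
    simp [Z]
  · rw [Function.update_of_ne hi]
    unfold Z
    by_cases h1 : i < h
    · simp [h1]
    · have h2 : (i - h).toNat = (i - h - 1).toNat + 1 := by omega
      simp only [h1, if_false, h2, List.map_cons, List.getD_cons_succ]
      simp

theorem Z_erase (h : ℤ) (r : List ℕ) (d : ℕ) :
    Function.update (Z h [] (d :: r)) h blank = Z (h + 1) [] r := by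
  funext i
  by_cases hi : i = h
  · subst hi
    simp [Z]
  · rw [Function.update_of_ne hi]
    unfold Z
    by_cases h1 : i < h
    · have h3 : i < h + 1 := by omega
      simp [h1, h3]
    · have h3 : ¬ i < h + 1 := by omega
      have h2 : (i - h).toNat = (i - (h + 1)).toNat + 1 := by omega
      simp only [h1, h3, if_false, h2, List.map_cons, List.getD_cons_succ]

theorem step_of {q q' : St} {h : ℤ} {t : ℤ → Sym} {s s' : Sym} {b : Bool} (hs : t h = s)
    (hd : delta q s = some (s', b, q')) :
    step ⟨q, h, t⟩ = some ⟨q', h + (if b then 1 else -1), Function.update t h s'⟩ := by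
  simp [step, hs, hd]

/-- `A` for remainder `0`, `B` for remainder `1`. -/
def rs (r : ℕ) : St := if r = 0 then A else B

theorem step_div (r d : ℕ) (hr : r < 2) (hd : d < 3) (h : ℤ) (l w : List ℕ) :
    step ⟨rs r, h, Z h l (d :: w)⟩ =
      some ⟨rs ((3 * r + d) % 2), h + 1, Z (h + 1) ((3 * r + d) / 2 :: l) w⟩ := by
  have hδ : delta (rs r) (symOfDigit d) =
      some (symOfDigit ((3 * r + d) / 2), true, rs ((3 * r + d) % 2)) := by
    interval_cases r <;> interval_cases d <;> rfl
  rw [step_of (Z_head h l w d) hδ, Z_write]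
  simp

theorem delta_left (q : St) (hq : q = C ∨ q = E) (d : ℕ) :
    delta q (symOfDigit d) = some (symOfDigit d, false, C) := by
  unfold symOfDigit
  rcases hq with rfl | rfl <;> split_ifs <;> rfl

theorem step_left (q : St) (hq : q = C ∨ q = E) (h : ℤ) (d : ℕ) (l r : List ℕ) :
    step ⟨q, h - 1, Z h (d :: l) r⟩ = some ⟨C, h - 1 - 1, Z (h - 1) l (d :: r)⟩ := by
  have hz : Z h (d :: l) r = Z (h - 1) l (d :: r) := by
    have := Z_shift (h - 1) d l r
    simpa using this
  rw [hz, step_of (Z_head (h - 1) l r d) (delta_left q hq d), Function.update_eq_self_iff.2 (Z_head _ _ _ _).symm]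
  simp [sub_eq_add_neg]

def Dc (h : ℤ) (w : List ℕ) : Cfg := ⟨D, h, Z h [] w⟩

theorem reach_C (h : ℤ) (l r : List ℕ) :
    ∃ h', Reach ⟨C, h - 1, Z h l r⟩ (Dc h' (l.reverse ++ r)) := by
  induction l generalizing h r with
  | nil =>
    refine ⟨h, Reach.head (step_of (Z_left_nil h r) rfl) ?_⟩
    rw [Function.update_eq_self_iff.2 (Z_left_nil h r).symm]
    simpa [Dc] using Reach.rfl' _
  | cons d l ih =>
    obtain ⟨h', hh⟩ := ih (h - 1) (d :: r)
    refine ⟨h', Reach.head (step_left C (Or.inl rfl) h d l r) ?_⟩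
    simpa using hh

def value : ℕ → List ℕ → ℕ
  | a, [] => a
  | a, d :: w => value (3 * a + d) w

theorem value_snoc (a : ℕ) (w : List ℕ) (d : ℕ) : value a (w ++ [d]) = 3 * value a w + d := by
  induction w generalizing a with
  | nil => rfl
  | cons e w ih => simp [value, ih]

theorem value_reverse (l : List ℕ) : value 0 l.reverse = Nat.ofDigits 3 l := by
  induction l with
  | nil => rfl
  | cons d l ih => simp [value_snoc, ih, Nat.ofDigits_cons]; ring

theorem value_ge (a : ℕ) (w : List ℕ) : a ≤ value a w := by
  induction w generalizing a with
  | nil => exact le_refl _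
  | cons d w ih => exact le_trans (by omega) (ih (3 * a + d))

theorem pass (w : List ℕ) : ∀ (r : ℕ) (_ : r < 2) (h : ℤ) (l : List ℕ)
    (_ : ∀ d ∈ w, d < 3) (_ : ∀ d ∈ l, d < 3) (_ : l ≠ [] ∨ w ≠ []),
    ∃ h' W, Reach ⟨rs r, h, Z h l w⟩ (Dc h' W) ∧ (∀ d ∈ W, d < 3) ∧
      value 0 W = T (value (2 * Nat.ofDigits 3 l + r) w) ∧
      W.length = l.length + w.length + (value (2 * Nat.ofDigits 3 l + r) w) % 2 := by
  induction w with
  | nil =>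
    intro r hr h l _ hl hne
    have hne : l ≠ [] := by simpa using hne
    interval_cases r
    · obtain ⟨h', hh⟩ := reach_C h l []
      refine ⟨h', l.reverse, ?_, ?_, ?_, ?_⟩
      · refine Reach.head (step_of (q := A) (Z_head_nil h l) rfl) ?_
        rw [Function.update_eq_self_iff.2 (Z_head_nil h l).symm]
        simpa [sub_eq_add_neg] using hh
      · simpa using hl
      · rw [value_reverse]; simp [value, T]
      · simp [value]
    · obtain ⟨s, l', rfl⟩ := List.exists_cons_of_ne_nil hne
      obtain ⟨h', hh⟩ := reach_C (h - 1) l' [s, 2]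
      refine ⟨h', l'.reverse ++ [s, 2], ?_, ?_, ?_, ?_⟩
      · refine Reach.head (step_of (q := B) (Z_head_nil h _) rfl) ?_
        have := Z_write_nil h (s :: l') 2
        have e : symOfDigit 2 = d2 := rfl
        rw [e] at this
        rw [this]
        exact Reach.head (step_left E (Or.inr rfl) h s l' [2]) hh
      · intro d hd
        simp at hd
        rcases hd with hd | hd | hd
        · exact hl d (by simp [hd])
        · exact hl d (by simp [hd])
        · omega
      · have : l'.reverse ++ [s, 2] = (s :: l').reverse ++ [2] := by simp
        rw [this, value_snoc, value_reverse]
        simp only [value]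
        unfold T
        rw [if_neg (by omega)]
        omega
      · simp [value]
  | cons d w ih =>
    intro r hr h l hw hl _
    have hd : d < 3 := hw d (by simp)
    obtain ⟨h', W, h1, h2, h3, h4⟩ := ih ((3 * r + d) % 2) (by omega) (h + 1)
      ((3 * r + d) / 2 :: l) (fun e he => hw e (by simp [he]))
      (by
        intro e he
        rcases List.mem_cons.1 he with rfl | he
        · omega
        · exact hl e he) (Or.inl (by simp))
    have key : 2 * Nat.ofDigits 3 ((3 * r + d) / 2 :: l) + (3 * r + d) % 2 =
        3 * (2 * Nat.ofDigits 3 l + r) + d := by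
      rw [Nat.ofDigits_cons]
      omega
    rw [key] at h3 h4
    refine ⟨h', W, Reach.head (step_div r d hr hd h l w) h1, h2, h3, ?_⟩
    simp only [value]
    rw [h4]
    simp
    omega

theorem halt_one (h : ℤ) : Halts (Dc h [1]) := by
  refine Reach.halts (Reach.head (step_of (q := D) (Z_head h [] [] 1) rfl) (Reach.rfl' _)) ?_
  rw [Z_erase]
  refine Reach.halts (Reach.head (step_of (q := B) (s := blank) (Z_head_nil _ _) rfl)
    (Reach.rfl' _)) ?_
  have := Z_write_nil (h + 1) [] 2
  have e : symOfDigit 2 = d2 := rfl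
  rw [e] at this
  simp only [if_true]
  rw [this]
  refine Reach.halts (Reach.head (step_of (q := E) (s := blank) (Z_left_nil _ _) rfl)
    (Reach.rfl' _)) ?_
  exact ⟨1, by simp [steps, step, delta]⟩

theorem passD (h : ℤ) (w : List ℕ) (hw : ∀ d ∈ w, d < 3) (hv : 0 < value 0 w) (h1 : w ≠ [1]) :
    ∃ c1 h' W, step (Dc h w) = some c1 ∧ Reach c1 (Dc h' W) ∧ (∀ d ∈ W, d < 3) ∧
      value 0 W = T (value 0 w) ∧
      (∀ w', w = 0 :: w' → W.length = w'.length + value 0 w % 2) := by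
  cases w with
  | nil => simp [value] at hv
  | cons d w =>
    have hd : d < 3 := hw d (by simp)
    have hw' : ∀ e ∈ w, e < 3 := fun e he => hw e (by simp [he])
    interval_cases d
    · have hne : w ≠ [] := by
        rintro rfl
        simp [value] at hv
      obtain ⟨h', W, g1, g2, g3, g4⟩ := pass w 0 (by omega) (h + 1) [] hw' (by simp) (Or.inr hne)
      refine ⟨_, h', W, step_of (q := D) (Z_head h [] w 0) rfl, ?_, g2, ?_, ?_⟩
      · rw [Z_erase]
        simpa [rs] using g1
      · simpa [value] using g3
      · rintro w' hw'
        obtain rfl : w = w' := by simpa using hw'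
        simpa [value] using g4
    · have hne : w ≠ [] := by
        rintro rfl
        simp at h1
      obtain ⟨h', W, g1, g2, g3, g4⟩ := pass w 1 (by omega) (h + 1) [] hw' (by simp) (Or.inr hne)
      refine ⟨_, h', W, step_of (q := D) (Z_head h [] w 1) rfl, ?_, g2, ?_, ?_⟩
      · rw [Z_erase]
        simpa [rs] using g1
      · simpa [value] using g3
      · simp
    · obtain ⟨h', W, g1, g2, g3, g4⟩ := pass w 0 (by omega) (h + 1) [1] hw' (by simp)
        (Or.inl (by simp))
      refine ⟨_, h', W, step_of (q := D) (Z_head h [] w 2) rfl, ?_, g2, ?_, ?_⟩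
      · have := Z_write h [] w 2 1
        have e : symOfDigit 1 = d1 := rfl
        rw [e] at this
        rw [this]
        simpa [rs] using g1
      · simpa [value] using g3
      · simp

theorem T_pos {v : ℕ} (hv : 0 < v) : 0 < T v := by
  unfold T
  split_ifs <;> omega

theorem halts_value_one (n : ℕ) : ∀ (h : ℤ) (w : List ℕ), w.length = n → (∀ d ∈ w, d < 3) →
    value 0 w = 1 → Halts (Dc h w) := by
  induction n with
  | zero =>
    intro h w hl _ hv
    obtain rfl := List.length_eq_zero_iff.1 hl
    simp [value] at hv
  | succ n ih =>
    intro h w hl hw hv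
    by_cases h1 : w = [1]
    · rw [h1]; exact halt_one h
    obtain ⟨c1, h', W, g1, g2, g3, g4, g5⟩ := passD h w hw (by omega) h1
    refine Reach.halts (Reach.head g1 g2) ?_
    have hT : T 1 = 2 := rfl
    rw [hv, hT] at g4
    -- the first digit of `w` is `0`
    obtain ⟨w', rfl⟩ : ∃ w', w = 0 :: w' := by
      match w, hv, h1 with
      | 0 :: w', _, _ => exact ⟨w', rfl⟩
      | [d + 1], hv, h1 => simp [value] at hv; simp [hv] at h1
      | (d + 1) :: e :: w', hv, _ =>
        have := value_ge (3 * (3 * 0 + (d + 1)) + e) w'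
        simp only [value] at hv
        omega
    have hlen := g5 w' rfl
    rw [hv] at hlen
    have hw'ne : w' ≠ [] := by
      rintro rfl
      simp [value] at hv
    have hpos := List.length_pos_iff.2 hw'ne
    obtain ⟨W', rfl⟩ : ∃ W', W = 0 :: W' := by
      match W, g4, hlen with
      | [], _, hlen => simp at hlen
      | 0 :: W', _, _ => exact ⟨W', rfl⟩
      | [d + 1], _, hlen => simp at hlen; exact absurd hlen hw'ne
      | (d + 1) :: e :: W', g4, _ =>
        have := value_ge (3 * (3 * 0 + (d + 1)) + e) W'
        simp only [value] at g4
        omega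
    obtain ⟨c2, h'', X, k1, k2, k3, k4, k5⟩ := passD h' (0 :: W') g3 (by omega) (by simp)
    refine Reach.halts (Reach.head k1 k2) (ih h'' X ?_ k3 ?_)
    · have := k5 W' rfl
      rw [g4] at this
      simp at this hlen hl
      omega
    · rw [k4, g4]; rfl

theorem halts_of_iter (k : ℕ) : ∀ (h : ℤ) (w : List ℕ), (∀ d ∈ w, d < 3) → 0 < value 0 w →
    T^[k] (value 0 w) = 1 → Halts (Dc h w) := by
  induction k with
  | zero => exact fun h w hw _ hk => halts_value_one _ h w rfl hw hk
  | succ k ih =>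
    intro h w hw hv hk
    by_cases h1 : w = [1]
    · rw [h1]; exact halt_one h
    obtain ⟨c1, h', W, g1, g2, g3, g4, _⟩ := passD h w hw hv h1
    refine Reach.halts (Reach.head g1 g2) (ih h' W g3 ?_ ?_)
    · rw [g4]; exact T_pos hv
    · rw [g4]; exact hk

theorem iter_of_halts (N : ℕ) : ∀ (h : ℤ) (w : List ℕ), (∀ d ∈ w, d < 3) → 0 < value 0 w →
    steps N (Dc h w) = none → ∃ k, T^[k] (value 0 w) = 1 := by
  induction N using Nat.strong_induction_on with
  | _ N ih =>
    intro h w hw hv hN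
    by_cases h1 : w = [1]
    · exact ⟨0, by simp [h1, value]⟩
    obtain ⟨c1, h', W, g1, g2, g3, g4, _⟩ := passD h w hw hv h1
    cases N with
    | zero => simp [steps] at hN
    | succ N =>
      simp only [steps, g1, Option.bind_some] at hN
      obtain ⟨M, hM, hM'⟩ := g2.back hN
      obtain ⟨k, hk⟩ := ih M (by omega) h' W g3 (by rw [g4]; exact T_pos hv) hM'
      exact ⟨k + 1, by rw [g4] at hk; exact hk⟩

theorem init_reach (x : ℕ) (hx : 0 < x) :
    ∃ h W, Reach (initCfg (base3Word x)) (Dc h W) ∧ (∀ d ∈ W, d < 3) ∧ value 0 W = T x := by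
  have hz : initCfg (base3Word x) = ⟨rs 0, 0, Z 0 [] (Nat.digits 3 x).reverse⟩ := by
    unfold initCfg base3Word tapeOf Z
    congr 1
    funext i
    by_cases hi : 0 ≤ i
    · have : ¬ i < 0 := by omega
      simp [hi, this]
    · have : i < 0 := by omega
      simp [hi, this]
  obtain ⟨h, W, g1, g2, g3, _⟩ := pass (Nat.digits 3 x).reverse 0 (by omega) 0 []
    (by
      intro d hd
      exact Nat.digits_lt_base (by omega) (List.mem_reverse.1 hd)) (by simp)
    (Or.inr (by simpa [Nat.digits_eq_nil_iff_eq_zero] using hx.ne'))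
  refine ⟨h, W, hz ▸ g1, g2, ?_⟩
  rw [g3]
  simp only [Nat.ofDigits_nil, Nat.mul_zero, Nat.add_zero]
  rw [value_reverse, Nat.ofDigits_digits]

/-- The 3x+1 conjecture holds iff for every positive integer `x`, written in base 3
as `x_k … x_0` (most significant digit first), the machine `M6` halts when started
from `ωb (A x_k) x_{k-1} … x_0 bω`. -/
theorem collatz_iff_M6_halts :
    CollatzConjecture ↔
      ∀ x : ℕ, 0 < x → Halts (initCfg (base3Word x)) := by
  constructor
  · intro hC x hx
    obtain ⟨h, W, g1, g2, g3⟩ := init_reach x hx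
    obtain ⟨k, _, hk⟩ := hC x hx
    refine g1.halts (halts_of_iter k h W g2 (by rw [g3]; exact T_pos hx) ?_)
    rw [g3]; exact hk
  · intro hH x hx
    obtain ⟨h, W, g1, g2, g3⟩ := init_reach x hx
    obtain ⟨N, hN⟩ := hH x hx
    obtain ⟨M, _, hM⟩ := g1.back hN
    obtain ⟨k, hk⟩ := iter_of_halts M h W g2 (by rw [g3]; exact T_pos hx) hM
    rw [g3] at hk
    have hk1 : T^[k + 1] x = 1 := hk
    refine ⟨k + 2, ?_, ?_⟩
    · rw [Function.iterate_succ_apply', hk1]; rfl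
    · rw [Function.iterate_succ_apply', Function.iterate_succ_apply', hk1]; rfl

end Collatz
end

section
/- Let x be a positive integer with standard base-3 representation x_k…x_0 (most significant digit first, x_k ≠ 0). The Turing machine M6 halts when started from the initial configuration ωb (A x_k) x_{k−1} … x_0 bω if and only if there exists m ≥ 0 with T^m(x) = 1. -/
namespace Collatz

open St Sym

/-- Configuration with left list `L` (nearest symbol first) and right list `R` (head symbol first). -/
def zip (q : St) (h : ℤ) (L R : List Sym) : Cfg :=
  ⟨q, h, fun i => if h ≤ i then R.getD (i - h).toNat blank else L.getD (h - 1 - i).toNat blank⟩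

theorem getD_append_blank (l : List Sym) (i : ℕ) :
    (l ++ [blank]).getD i blank = l.getD i blank := by
  induction l generalizing i with
  | nil => cases i <;> simp
  | cons a l ih => cases i with
    | zero => simp
    | succ i => simpa using ih i

theorem zip_left (q h L R) : zip q h (L ++ [blank]) R = zip q h L R := by
  unfold zip; simp only [getD_append_blank]

theorem zip_right (q h L R) : zip q h L (R ++ [blank]) = zip q h L R := by
  unfold zip; simp only [getD_append_blank]

theorem step_right {q s s' q'} (hd : delta q s = some (s', true, q')) (h L R) :
    step (zip q h L (s :: R)) = some (zip q' (h + 1) (s' :: L) R) := by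
  have hs : (zip q h L (s :: R)).tape h = s := by simp [zip]
  have hd' : delta (zip q h L (s :: R)).state ((zip q h L (s :: R)).tape (zip q h L (s :: R)).head)
      = some (s', true, q') := by
    rw [← hd]; exact congrArg _ hs
  unfold step
  rw [hd']
  simp only [Option.map_some, zip, Option.some.injEq, Cfg.mk.injEq, true_and, if_true]
  funext i
  simp only [Function.update_apply]
  rcases lt_trichotomy i h with hi | hi | hi
  · rw [if_neg (by omega), if_neg (by omega), if_neg (by omega)]
    have : (h + 1 - 1 - i).toNat = (h - 1 - i).toNat + 1 := by omega
    rw [this]; simp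
  · subst hi; simp
  · rw [if_neg (by omega), if_pos (by omega), if_pos (by omega)]
    have : (i - h).toNat = (i - (h + 1)).toNat + 1 := by omega
    rw [this]; simp

theorem step_left_s12 {q s s' q'} (hd : delta q s = some (s', false, q')) (h l L R) :
    step (zip q h (l :: L) (s :: R)) = some (zip q' (h - 1) L (l :: s' :: R)) := by
  have hs : (zip q h (l :: L) (s :: R)).tape h = s := by simp [zip]
  have hd' : delta (zip q h (l :: L) (s :: R)).state
      ((zip q h (l :: L) (s :: R)).tape (zip q h (l :: L) (s :: R)).head)
      = some (s', false, q') := by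
    rw [← hd]; exact congrArg _ hs
  unfold step
  rw [hd']
  simp only [Option.map_some, zip, Option.some.injEq, Cfg.mk.injEq, true_and]
  refine ⟨by simp; omega, ?_⟩
  funext i
  simp only [Function.update_apply]
  by_cases h1 : i < h - 1
  · rw [if_neg (by omega), if_neg (by omega), if_neg (by omega)]
    have : (h - 1 - i).toNat = (h - 1 - 1 - i).toNat + 1 := by omega
    rw [this]; simp
  by_cases h2 : i = h - 1
  · subst h2; simp
  by_cases h3 : i = h
  · subst h3; simp
  rw [if_neg (by omega), if_pos (by omega), if_pos (by omega)]
  obtain ⟨k, hk⟩ : ∃ k : ℕ, i = h + 1 + k := ⟨(i - h - 1).toNat, by omega⟩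
  have e1 : (i - h).toNat = k + 1 := by omega
  have e2 : (i - (h - 1)).toNat = k + 2 := by omega
  rw [e1, e2]; simp

theorem steps_add (m n : ℕ) (c : Cfg) : steps (m + n) c = (steps m c).bind (steps n) := by
  induction m generalizing c with
  | zero => simp [steps]
  | succ m ih =>
    rw [Nat.succ_add]
    simp only [steps]
    cases step c with
    | none => rfl
    | some c' => simpa using ih c'

/-- `c` reaches `c'`. -/
def Star (c c' : Cfg) : Prop := ∃ n, steps n c = some c'

/-- `c` reaches `c'` in at least one step. -/
def Plus (c c' : Cfg) : Prop := ∃ n, steps (n + 1) c = some c'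

theorem Star.refl (c) : Star c c := ⟨0, rfl⟩

theorem Star.trans {a b c} (h1 : Star a b) (h2 : Star b c) : Star a c := by
  obtain ⟨m, hm⟩ := h1; obtain ⟨n, hn⟩ := h2
  exact ⟨m + n, by rw [steps_add, hm]; exact hn⟩

theorem Plus.of_step {a b c} (h1 : step a = some b) (h2 : Star b c) : Plus a c := by
  obtain ⟨n, hn⟩ := h2
  exact ⟨n, by simp [steps, h1, hn]⟩

theorem Plus.star {a b} (h : Plus a b) : Star a b := by
  obtain ⟨n, hn⟩ := h; exact ⟨_, hn⟩

theorem Star.of_step {a b c} (h1 : step a = some b) (h2 : Star b c) : Star a c :=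
  (Plus.of_step h1 h2).star

theorem Plus.trans_star {a b c} (h1 : Plus a b) (h2 : Star b c) : Plus a c := by
  obtain ⟨m, hm⟩ := h1; obtain ⟨n, hn⟩ := h2
  refine ⟨m + n, ?_⟩
  rw [show m + n + 1 = (m + 1) + n by omega, steps_add, hm]; exact hn

theorem Star.halts {a b} (h : Star a b) (hb : Halts b) : Halts a := by
  obtain ⟨m, hm⟩ := h; obtain ⟨n, hn⟩ := hb
  exact ⟨m + n, by rw [steps_add, hm]; exact hn⟩

/-- digit value -/
def dv : Sym → ℕ
  | blank => 0
  | d0 => 0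
  | d1 => 1
  | d2 => 2

/-- base-3 value with accumulator -/
def val : ℕ → List Sym → ℕ
  | a, [] => a
  | a, s :: w => val (3 * a + dv s) w

theorem val_append (a u v) : val a (u ++ v) = val (val a u) v := by
  induction u generalizing a with
  | nil => rfl
  | cons s u ih => exact ih _

theorem le_val (a w) : a ≤ val a w := by
  induction w generalizing a with
  | nil => exact le_rfl
  | cons s w ih => exact le_trans (by omega) (ih _)

/-- all symbols are digits -/
def Dig (w : List Sym) : Prop := ∀ s ∈ w, s ≠ blank

/-- carry as a state -/
def cs (r : Bool) : St := if r then B else A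

theorem sweep (w : List Sym) (hw : Dig w) : ∀ (r : Bool) (h : ℤ) (L : List Sym),
    ∃ (u : List Sym) (r' : Bool) (h' : ℤ), Dig u ∧ u.length = w.length ∧
      (∀ a, val (2 * a + r.toNat) w = 2 * val a u + r'.toNat) ∧
      Star (zip (cs r) h L w) (zip (cs r') h' (u.reverse ++ L) []) ∧
      (r = true → (u = [] ∧ r' = true) ∨ ∃ s t, u = s :: t ∧ s ≠ d0) := by
  induction w with
  | nil =>
    intro r h L
    exact ⟨[], r, h, by simp [Dig], rfl, fun a => rfl, Star.refl _, by simp⟩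
  | cons s w ih =>
    intro r h L
    have hs : s ≠ blank := hw s (by simp)
    have hw' : Dig w := fun x hx => hw x (by simp [hx])
    have key : ∃ s' r1, s' ≠ blank ∧ delta (cs r) s = some (s', true, cs r1) ∧
        3 * r.toNat + dv s = 2 * dv s' + r1.toNat ∧ (r = true → s' ≠ d0) := by
      cases r <;> cases s
      · exact absurd rfl hs
      · exact ⟨d0, false, by simp, rfl, rfl, by simp⟩
      · exact ⟨d0, true, by simp, rfl, rfl, by simp⟩
      · exact ⟨d1, false, by simp, rfl, rfl, by simp⟩
      · exact absurd rfl hs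
      · exact ⟨d1, true, by simp, rfl, rfl, by simp⟩
      · exact ⟨d2, false, by simp, rfl, rfl, by simp⟩
      · exact ⟨d2, true, by simp, rfl, rfl, by simp⟩
    obtain ⟨s', r1, hb, hd, hv, hr⟩ := key
    obtain ⟨u, r', h', hu, hl, hval, hst, -⟩ := ih hw' r1 (h + 1) (s' :: L)
    refine ⟨s' :: u, r', h', ?_, by simp [hl], ?_, ?_, fun h => Or.inr ⟨s', u, rfl, hr h⟩⟩
    · intro x hx
      rcases List.mem_cons.1 hx with rfl | hx
      · exact hb
      · exact hu x hx
    · intro a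
      simp only [val]
      rw [← hval]
      congr 1; omega
    · refine Star.of_step (step_right hd h L w) ?_
      simpa using hst

theorem zip_left_nil (q h R) : zip q h [blank] R = zip q h [] R := zip_left q h [] R
theorem zip_right_nil (q h L) : zip q h L [blank] = zip q h L [] := zip_right q h L []

theorem sweepC (L : List Sym) (hL : Dig L) : ∀ (q : St) (s : Sym) (h : ℤ) (R : List Sym),
    q = C ∨ q = E → s ≠ blank →
    ∃ h', Star (zip q h L (s :: R)) (zip D h' [] (L.reverse ++ s :: R)) := by
  induction L with
  | nil =>
    intro q s h R hq hs
    have hd : delta q s = some (s, false, C) := by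
      rcases hq with rfl | rfl <;> cases s <;> first | rfl | exact absurd rfl hs
    rw [← zip_left_nil q]
    refine ⟨h - 1 + 1, Star.of_step (step_left_s12 hd h _ _ _)
      (Star.of_step (step_right (q := C) (s := blank) rfl _ _ _) ?_)⟩
    rw [zip_left_nil]
    exact Star.refl _
  | cons l L ih =>
    intro q s h R hq hs
    have hd : delta q s = some (s, false, C) := by
      rcases hq with rfl | rfl <;> cases s <;> first | rfl | exact absurd rfl hs
    obtain ⟨h', hst⟩ := ih (fun x hx => hL x (by simp [hx])) C l (h - 1) (s :: R) (Or.inl rfl)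
      (hL l (by simp))
    exact ⟨h', Star.of_step (step_left_s12 hd h _ _ _) (by simpa using hst)⟩

/-- Result word after sweeping. -/
def fin (u : List Sym) (r : Bool) : List Sym := if r then u ++ [d2] else u

theorem finish (u : List Sym) (hu : Dig u) (hne : u ≠ []) (r : Bool) (h : ℤ) :
    ∃ h', Star (zip (cs r) h u.reverse []) (zip D h' [] (fin u r)) := by
  obtain ⟨v, l, rfl⟩ : ∃ v l, u = v ++ [l] :=
    ⟨_, _, (List.dropLast_append_getLast hne).symm⟩
  have hv : Dig v.reverse := fun x hx => hu x (by simp at hx; simp [hx])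
  have hl : l ≠ blank := hu l (by simp)
  rw [← zip_right_nil]
  cases r with
  | false =>
    obtain ⟨h', hst⟩ := sweepC v.reverse hv C l (h - 1) [blank] (Or.inl rfl) hl
    refine ⟨h', ?_⟩
    rw [List.reverse_append]
    refine Star.of_step (step_left_s12 (q := A) (s := blank) rfl h _ _ _) ?_
    have e : v.reverse.reverse ++ l :: [blank] = (v ++ [l]) ++ [blank] := by simp
    rw [e, zip_right] at hst
    exact hst
  | true =>
    obtain ⟨h', hst⟩ := sweepC v.reverse hv E l (h - 1) [d2] (Or.inr rfl) hl
    refine ⟨h', ?_⟩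
    rw [List.reverse_append]
    refine Star.of_step (step_left_s12 (q := B) (s := blank) rfl h _ _ _) ?_
    have e : v.reverse.reverse ++ l :: [d2] = (v ++ [l]) ++ [d2] := by simp
    rw [e] at hst
    exact hst

/-- `w` is a standard representation of `x`. -/
def Good (w : List Sym) (x : ℕ) : Prop :=
  ∃ s t, w = s :: t ∧ Dig w ∧ s ≠ d0 ∧ val 0 w = x

/-- Canonical configurations for `x`. -/
def Can (x : ℕ) (c : Cfg) : Prop :=
  ∃ q h w, (q = A ∨ q = D) ∧ Good w x ∧ c = zip q h [] w

theorem good_fin {s u x r} (hd : Dig (s :: u)) (hs : s ≠ d0)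
    (hx : x = 2 * val 0 (s :: u) + r.toNat) : Good (fin (s :: u) r) (T x) := by
  cases r with
  | false =>
    refine ⟨s, u, rfl, hd, hs, ?_⟩
    have e : fin (s :: u) false = s :: u := rfl
    have h1 : x = 2 * val 0 (s :: u) := hx
    rw [e, T, if_pos (by omega)]; omega
  | true =>
    refine ⟨s, u ++ [d2], by simp [fin], ?_, hs, ?_⟩
    · intro y hy
      simp only [fin, if_true, List.mem_append, List.mem_singleton] at hy
      rcases hy with hy | rfl
      · exact hd y hy
      · simp
    · have e : val 0 (fin (s :: u) true) = 3 * val 0 (s :: u) + 2 := by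
        simp only [fin, if_true]
        rw [val_append]; rfl
      have h1 : x = 2 * val 0 (s :: u) + 1 := hx
      rw [e, T, if_neg (by omega)]; omega

theorem can_step {x c} (hc : Can x c) (hx : x ≠ 1) : ∃ c', Plus c c' ∧ Can (T x) c' := by
  obtain ⟨q, h, w, hq, ⟨s, w, rfl, hdig, hs, hval⟩, rfl⟩ := hc
  have hs' : s ≠ blank := hdig s (by simp)
  have hw : Dig w := fun y hy => hdig y (by simp [hy])
  have hs2 : s = d1 ∨ s = d2 := by cases s <;> simp_all
  rcases hs2 with rfl | rfl
  · rcases hq with rfl | rfl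
    · -- A on 1
      obtain ⟨u, r, h', hu, hl, hv, hst, hB⟩ := sweep w hw true (h + 1) [d0]
      have hu0 : Dig (d0 :: u) := by
        intro y hy
        rcases List.mem_cons.1 hy with rfl | hy
        · simp
        · exact hu y hy
      obtain ⟨h2, hfin⟩ := finish (d0 :: u) hu0 (by simp) r h'
      have hv0 := hv 0
      simp only [val, dv, Bool.toNat_true, Nat.mul_zero, Nat.zero_add] at hv0 hval
      have hg : Good (fin u r) (T x) := by
        rcases hB rfl with ⟨rfl, rfl⟩ | ⟨s, t, rfl, hs⟩
        · have : x = 1 := by rw [← hval, hv0]; rfl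
          exact absurd this hx
        · exact good_fin hu hs (by rw [← hval, hv0])
      have e : fin (d0 :: u) r = d0 :: fin u r := by cases r <;> simp [fin]
      refine ⟨zip A (h2 + 1) [] (fin u r), ?_, A, _, _, Or.inl rfl, hg, rfl⟩
      refine Plus.of_step (step_right (q := A) (s := d1) rfl _ _ _) (hst.trans ?_)
      rw [show u.reverse ++ [d0] = (d0 :: u).reverse by simp]
      refine hfin.trans ?_
      rw [e]
      refine Star.of_step (step_right (q := D) (s := d0) rfl _ _ _) ?_
      rw [zip_left_nil]; exact Star.refl _
    · -- D on 1
      obtain ⟨u, r, h', hu, hl, hv, hst, hB⟩ := sweep w hw true (h + 1) [blank]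
      have hv0 := hv 0
      simp only [val, dv, Bool.toNat_true, Nat.mul_zero, Nat.zero_add] at hv0 hval
      rcases hB rfl with ⟨rfl, rfl⟩ | ⟨s, t, rfl, hs⟩
      · have : x = 1 := by rw [← hval, hv0]; rfl
        exact absurd this hx
      obtain ⟨h2, hfin⟩ := finish (s :: t) hu (by simp) r h'
      refine ⟨zip D h2 [] (fin (s :: t) r), ?_, D, _, _, Or.inr rfl,
        good_fin hu hs (by rw [← hval, hv0]), rfl⟩
      refine Plus.of_step (step_right (q := D) (s := d1) rfl _ _ _) (hst.trans ?_)
      rw [zip_left]; exact hfin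
  · obtain ⟨u, r, h', hu, hl, hv, hst, hB⟩ := sweep w hw false (h + 1) [d1]
    have hu0 : Dig (d1 :: u) := by
      intro y hy
      rcases List.mem_cons.1 hy with rfl | hy
      · simp
      · exact hu y hy
    obtain ⟨h2, hfin⟩ := finish (d1 :: u) hu0 (by simp) r h'
    have hv1 := hv 1
    simp only [val, dv, Bool.toNat_false, Nat.mul_zero, Nat.mul_one, Nat.zero_add,
      Nat.add_zero] at hv1 hval
    refine ⟨zip D h2 [] (fin (d1 :: u) r), ?_, D, _, _, Or.inr rfl,
        good_fin hu0 (by simp) (by rw [← hval, hv1]; rfl), rfl⟩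
    have hd : delta q d2 = some (d1, true, A) := by rcases hq with rfl | rfl <;> rfl
    refine Plus.of_step (step_right hd _ _ _) (hst.trans ?_)
    rw [show u.reverse ++ [d1] = (d1 :: u).reverse by simp]
    exact hfin

theorem haltsD (h : ℤ) : Halts (zip D h [] [d1]) := by
  refine Star.halts (b := zip H (h + 1 - 1 + 1) [blank] [d2]) ?_ ⟨1, rfl⟩
  refine Star.of_step (step_right (q := D) (s := d1) rfl _ _ _) ?_
  rw [← zip_right_nil]
  refine Star.of_step (step_left_s12 (q := B) (s := blank) rfl _ _ _ _) ?_
  exact Star.of_step (step_right (q := E) (s := blank) rfl _ _ _) (Star.refl _)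

theorem can_one {c} (hc : Can 1 c) : Halts c := by
  obtain ⟨q, h, w, hq, ⟨s, w, rfl, hdig, hs, hval⟩, rfl⟩ := hc
  have hs' : s ≠ blank := hdig s (by simp)
  have hs2 : 1 ≤ dv s := by cases s <;> simp_all [dv]
  cases w with
  | cons s2 w =>
    simp only [val] at hval
    have := le_val (3 * (3 * 0 + dv s) + dv s2) w
    omega
  | nil =>
    have : s = d1 := by cases s <;> simp_all [dv, val]
    subst this
    rcases hq with rfl | rfl
    · obtain ⟨h1, hf⟩ := finish [d0] (by simp [Dig]) (by simp) true (h + 1)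
      refine Star.halts (Star.of_step (step_right (q := A) (s := d1) rfl _ _ _) hf) ?_
      refine Star.halts (Star.of_step (step_right (q := D) (s := d0) rfl _ _ _) (Star.refl _)) ?_
      rw [zip_left_nil]
      have hst := Star.of_step (step_right (q := A) (s := d2) rfl (h1 + 1) [] []) (Star.refl _)
      refine Star.halts hst ?_
      obtain ⟨h3, hf3⟩ := finish [d1] (by simp [Dig]) (by simp) false (h1 + 1 + 1)
      exact Star.halts hf3 (haltsD h3)
    · exact haltsD h

theorem halts_of_iter_s12 (m : ℕ) : ∀ x c, Can x c → T^[m] x = 1 → Halts c := by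
  induction m with
  | zero => intro x c hc hx; simp at hx; subst hx; exact can_one hc
  | succ m ih =>
    intro x c hc hx
    by_cases h1 : x = 1
    · subst h1; exact can_one hc
    · obtain ⟨c', hp, hc'⟩ := can_step hc h1
      exact hp.star.halts (ih _ _ hc' (by simpa using hx))

theorem iter_of_halts_s12 (n : ℕ) : ∀ x c, Can x c → steps n c = none → ∃ m, T^[m] x = 1 := by
  induction n using Nat.strong_induction_on with
  | _ n ih =>
    intro x c hc hn
    by_cases h1 : x = 1
    · exact ⟨0, h1⟩
    obtain ⟨c', ⟨k, hk⟩, hc'⟩ := can_step hc h1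
    by_cases hkn : k + 1 ≤ n
    · obtain ⟨j, rfl⟩ := Nat.exists_eq_add_of_le hkn
      rw [steps_add, hk] at hn
      obtain ⟨m, hm⟩ := ih j (by omega) _ _ hc' hn
      exact ⟨m + 1, by simpa using hm⟩
    · obtain ⟨j, hj⟩ := Nat.exists_eq_add_of_le (show n ≤ k + 1 by omega)
      rw [hj, steps_add, hn] at hk
      simp at hk

theorem val_digits (l : List ℕ) (hl : ∀ d ∈ l, d < 3) :
    val 0 (l.reverse.map symOfDigit) = Nat.ofDigits 3 l := by
  induction l with
  | nil => rfl
  | cons d l ih =>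
    rw [List.reverse_cons, List.map_append, val_append, ih (fun x hx => hl x (by simp [hx])),
      Nat.ofDigits_cons]
    have h3 := hl d (by simp)
    have : dv (symOfDigit d) = d := by interval_cases d <;> rfl
    simp only [List.map_cons, List.map_nil, val, this]
    omega

theorem good_base3 (x : ℕ) (hx : 0 < x) : Good (base3Word x) x := by
  have hne : Nat.digits 3 x ≠ [] := Nat.digits_ne_nil_iff_ne_zero.2 hx.ne'
  have hlast := Nat.getLast_digit_ne_zero 3 hx.ne'
  refine ⟨symOfDigit ((Nat.digits 3 x).getLast hne),
    ((Nat.digits 3 x).dropLast.reverse).map symOfDigit, ?_, ?_, ?_, ?_⟩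
  · unfold base3Word
    conv_lhs => rw [← List.dropLast_append_getLast hne]
    simp
  · intro s hs
    obtain ⟨d, -, rfl⟩ := List.mem_map.1 hs
    unfold symOfDigit; split_ifs <;> simp
  · unfold symOfDigit; rw [if_neg hlast]; split_ifs <;> simp
  · unfold base3Word
    rw [val_digits _ (fun d hd => Nat.digits_lt_base (by norm_num) hd), Nat.ofDigits_digits]

theorem init_eq (w) : initCfg w = zip A 0 [] w := by
  unfold initCfg zip tapeOf
  simp

/-- For a positive integer `x` with standard base-3 representation `x_k … x_0`,
the machine `M6` halts when started from `ωb (A x_k) x_{k-1} … x_0 bω`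
iff some iterate of `T` at `x` is `1`. -/
theorem M6_halts_iff_iterate_one (x : ℕ) (hx : 0 < x) :
    Halts (initCfg (base3Word x)) ↔ (∃ m : ℕ, T^[m] x = 1) := by
  have hc : Can x (initCfg (base3Word x)) :=
    ⟨A, 0, _, Or.inl rfl, good_base3 x hx, init_eq _⟩
  exact ⟨fun ⟨n, hn⟩ => iter_of_halts_s12 n _ _ hc hn, fun ⟨m, hm⟩ => halts_of_iter_s12 m _ _ hc hm⟩

end Collatz
end
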